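/- arXiv:2512.06317 — 2 statements merged into one kernel-verified Lean document; each statement's English description precedes it below -/
import Mathlib

section
/- Let 1 ≤ p < ∞. A real Banach space X has the Lipschitz p-approximation property if and only if β_X lies in the 𝒯δ_p-closure of 𝓕(F(X),X). -/
open scoped NNReal ZeroAtInfty
open Metric Set

/-- A Lipschitz map vanishing at `0` (an element of `Lip₀(X, Y)`). -/
def IsLip0 {X Y : Type*} [NormedAddCommGroup X] [NormedAddCommGroup Y] (f : X → Y) : Prop :=
  f 0 = 0 ∧ ∃ K : ℝ≥0, LipschitzWith K f

/-- A Lipschitz finite-rank operator: a Lipschitz map vanishing at `0` whose range spans a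
finite-dimensional subspace (an element of `Lip₀𝓕(X, Y)`). -/
def IsLipFinRank {X Y : Type*} [NormedAddCommGroup X] [NormedAddCommGroup Y] [NormedSpace ℝ Y]
    (f : X → Y) : Prop :=
  IsLip0 f ∧ FiniteDimensional ℝ (Submodule.span ℝ (Set.range f))

/-- A finite-rank bounded linear operator (an element of `𝓕(Z, W)`). -/
def IsFinRank {Z W : Type*} [NormedAddCommGroup Z] [NormedSpace ℝ Z] [NormedAddCommGroup W]
    [NormedSpace ℝ W] (T : Z →L[ℝ] W) : Prop :=
  FiniteDimensional ℝ (LinearMap.range (T : Z →ₗ[ℝ] W))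

/-- `a` belongs to the closed unit ball of `ℓ_{p'}`, where `p'` is the conjugate exponent of
`p` (`p' = ∞` when `p = 1`, `p' = p / (p - 1)` when `p > 1`). -/
def InBallConj (p : ℝ) (a : ℕ → ℝ) : Prop :=
  (p = 1 ∧ ∀ n, |a n| ≤ 1) ∨
    (p ≠ 1 ∧ Summable (fun n => |a n| ^ (p / (p - 1))) ∧ (∑' n, |a n| ^ (p / (p - 1))) ≤ 1)

/-- `K` is relatively `p`-compact: `K` is contained in the `p`-convex hull of a strongly
`p`-summable sequence. -/
def RelPCompact (p : ℝ) {Z : Type*} [NormedAddCommGroup Z] [NormedSpace ℝ Z]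
    (K : Set Z) : Prop :=
  ∃ z : ℕ → Z, Summable (fun n => ‖z n‖ ^ p) ∧
    ∀ w ∈ K, ∃ a : ℕ → ℝ, InBallConj p a ∧ HasSum (fun n => a n • z n) w

/-- `X` has the Lipschitz `p`-approximation property: `Id_X` lies in the `τ_p`-closure of the
Lipschitz finite-rank operators. -/
def LipPAP (p : ℝ) (X : Type*) [NormedAddCommGroup X] [NormedSpace ℝ X] : Prop :=
  ∀ K : Set X, RelPCompact p K → ∀ ε : ℝ, 0 < ε →
    ∃ f : X → X, IsLipFinRank f ∧ ∀ x ∈ K, ‖x - f x‖ < ε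

/-- `δ : X → FX` realizes `FX` as the Lipschitz-free space `F(X)` over `X`: `δ` is an isometry
vanishing at `0` whose range has dense linear span, and every Lipschitz map `f` vanishing at `0`
into a Banach space admits a (unique, by density) bounded linear factorization `T` through `δ`
with `‖T‖ ≤ Lip(f)`. -/
structure IsFreeSpace {X FX : Type*} [NormedAddCommGroup X] [NormedSpace ℝ X]
    [NormedAddCommGroup FX] [NormedSpace ℝ FX] (δ : X → FX) : Prop where
  map_zero : δ 0 = 0
  isometry : Isometry δ
  dense_span : Dense ((Submodule.span ℝ (Set.range δ) : Submodule ℝ FX) : Set FX)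
  lift : ∀ {Y : Type*} [NormedAddCommGroup Y] [NormedSpace ℝ Y] [CompleteSpace Y]
      (f : X → Y) (K : ℝ≥0), f 0 = 0 → LipschitzWith K f →
      ∃ T : FX →L[ℝ] Y, (∀ x, T (δ x) = f x) ∧ ‖T‖ ≤ K

/-- A Lipschitz finite-rank operator factors through the free space by a finite-rank operator. -/
theorem IsFreeSpace.exists_isFinRank {X FX Y : Type*}
    [NormedAddCommGroup X] [NormedSpace ℝ X] [NormedAddCommGroup FX] [NormedSpace ℝ FX]
    [NormedAddCommGroup Y] [NormedSpace ℝ Y]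
    {δ : X → FX} (hδ : IsFreeSpace δ) {f : X → Y} (hf : IsLipFinRank f) :
    ∃ S : FX →L[ℝ] Y, IsFinRank S ∧ ∀ x, S (δ x) = f x := by
  obtain ⟨⟨hf0, K, hK⟩, hfin⟩ := hf
  set V := Submodule.span ℝ (Set.range f)
  let g : X → V := fun x => ⟨f x, Submodule.subset_span ⟨x, rfl⟩⟩
  have hg : LipschitzWith K g := fun x y => hK x y
  let e : V ≃L[ℝ] (Fin (Module.finrank ℝ V) → ℝ) :=
    ContinuousLinearEquiv.ofFinrankEq (by simp)
  -- the universe of the codomains in `hδ.lift` need not be that of `Y`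
  let u := (ContinuousLinearEquiv.ulift (R₁ := ℝ) (M₁ := Fin (Module.finrank ℝ V) → ℝ)).symm
  let E := e.trans u
  obtain ⟨T, hT, -⟩ := hδ.lift (fun x => E (g x)) _
    (by simp [g, hf0]) (E.lipschitz.comp hg)
  refine ⟨V.subtypeL.comp ((E.symm : _ →L[ℝ] V).comp T), ?_, fun x => ?_⟩
  · refine Submodule.finiteDimensional_of_le (S₂ := V) ?_
    rintro _ ⟨x, rfl⟩
    exact (E.symm (T x)).2
  · simp [hT, g]

/-- The composition of a finite-rank operator with a Lipschitz map vanishing at `0`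
is a Lipschitz finite-rank operator. -/
theorem IsFinRank.isLipFinRank_comp {X Z Y : Type*}
    [NormedAddCommGroup X] [NormedAddCommGroup Z] [NormedSpace ℝ Z]
    [NormedAddCommGroup Y] [NormedSpace ℝ Y] {S : Z →L[ℝ] Y} (hS : IsFinRank S)
    {d : X → Z} (hd : IsLip0 d) : IsLipFinRank (S ∘ d) := by
  obtain ⟨hd0, K, hK⟩ := hd
  refine ⟨⟨by simp [hd0], _, S.lipschitz.comp hK⟩, ?_⟩
  have : FiniteDimensional ℝ (LinearMap.range (S : Z →ₗ[ℝ] Y)) := hS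
  refine Submodule.finiteDimensional_of_le (S₂ := LinearMap.range (S : Z →ₗ[ℝ] Y)) ?_
  rw [Submodule.span_le]
  rintro _ ⟨x, rfl⟩
  exact ⟨d x, rfl⟩

theorem stmt_11 (p : ℝ) (hp : 1 ≤ p) {X FX : Type*}
    [NormedAddCommGroup X] [NormedSpace ℝ X] [CompleteSpace X]
    [NormedAddCommGroup FX] [NormedSpace ℝ FX] [CompleteSpace FX]
    (δ : X → FX) (hδ : IsFreeSpace δ)
    (β : FX →L[ℝ] X) (hβ : ∀ x : X, β (δ x) = x) :
    LipPAP p X ↔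
      ∀ K : Set X, RelPCompact p K → ∀ ε : ℝ, 0 < ε →
        ∃ S : FX →L[ℝ] X, IsFinRank S ∧ ∀ x ∈ K, ‖β (δ x) - S (δ x)‖ < ε := by
  constructor
  · intro h K hK ε hε
    obtain ⟨f, hf, hfK⟩ := h K hK ε hε
    obtain ⟨S, hS, hSf⟩ := hδ.exists_isFinRank hf
    exact ⟨S, hS, fun x hx => by simpa only [hβ, hSf] using hfK x hx⟩
  · intro h K hK ε hε
    obtain ⟨S, hS, hSK⟩ := h K hK ε hε
    exact ⟨S ∘ δ, hS.isLipFinRank_comp ⟨hδ.map_zero, 1, hδ.isometry.lipschitz⟩,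
      fun x hx => by simpa only [hβ, Function.comp_apply] using hSK x hx⟩
end

section
/- Let 1 ≤ p < ∞. For a real Banach space X, if the Lipschitz-free space F(X) has the p-approximation property, then X has the p-approximation property, and consequently X has the Lipschitz p-approximation property. -/
open scoped NNReal ZeroAtInfty
open Metric Set

/-- `Z` has the `p`-approximation property: the identity can be approximated uniformly on every
relatively `p`-compact set by finite-rank bounded linear operators. -/
def PAP (p : ℝ) (Z : Type*) [NormedAddCommGroup Z] [NormedSpace ℝ Z] : Prop :=
  ∀ K : Set Z, RelPCompact p K → ∀ ε : ℝ, 0 < ε →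
    ∃ T : Z →L[ℝ] Z, IsFinRank T ∧ ∀ z ∈ K, ‖T z - z‖ < ε

open Filter Topology Asymptotics

section Averaging

variable {X F : Type*} [NormedAddCommGroup X] [NormedSpace ℝ X]
  [NormedAddCommGroup F] [NormedSpace ℝ F]

/-- The average of `g` over the segment `[t, t + e]`, as a function of `t`. -/
noncomputable def segAvg (e : X) (g : X → F) (t : X) : F := ∫ u in (0 : ℝ)..1, g (t + u • e)

/-- A quantitative, derivative-free form of continuous differentiability along `e`. -/
def SmoothAlong (e : X) (C : ℝ) (g : X → F) : Prop :=
  ∀ (t t' : X) (h h' : ℝ), ‖h' • (g (t + h • e) - g t) - h • (g (t' + h' • e) - g t')‖ ≤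
    C * (|h| * |h'| * (|h| + |h'| + ‖t - t'‖))

/-- `w` is the strict derivative of `G` at `0` in the direction `z`. -/
def HasStrictDirDeriv (G : X → F) (z : X) (w : F) : Prop :=
  (fun q : X × ℝ => G (q.1 + q.2 • z) - G q.1 - q.2 • w) =o[𝓝 0] (fun q => q.2)

lemma intervalIntegrable_segment {X F : Type*} [NormedAddCommGroup X] [NormedSpace ℝ X]
    [NormedAddCommGroup F] {g : X → F} (hg : Continuous g) (t e : X) (a b : ℝ) :
    IntervalIntegrable (fun u : ℝ => g (t + u • e)) MeasureTheory.volume a b :=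
  (by fun_prop : Continuous fun u : ℝ => g (t + u • e)).intervalIntegrable a b

lemma norm_segAvg_sub_le {g : X → F} (hg : LipschitzWith 1 g) (e s t : X) :
    ‖segAvg e g s - segAvg e g t‖ ≤ ‖s - t‖ := by
  unfold segAvg
  rw [← intervalIntegral.integral_sub (intervalIntegrable_segment hg.continuous ..)
    (intervalIntegrable_segment hg.continuous ..)]
  refine (intervalIntegral.norm_integral_le_of_norm_le_const (C := ‖s - t‖) fun u _ => ?_).trans
    (by simp)
  simpa using hg.norm_sub_le (s + u • e) (t + u • e)

lemma lipschitzWith_segAvg {g : X → F} (hg : LipschitzWith 1 g) (e : X) :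
    LipschitzWith 1 (segAvg e g) :=
  LipschitzWith.of_dist_le_mul fun s t => by
    simpa [dist_eq_norm] using norm_segAvg_sub_le hg e s t

lemma norm_segAvg_sub_self_le [CompleteSpace F] {g : X → F} (hg : LipschitzWith 1 g) (e t : X) :
    ‖segAvg e g t - g t‖ ≤ ‖e‖ := by
  have hconst : g t = ∫ _ in (0 : ℝ)..1, g t := by simp
  unfold segAvg
  rw [hconst, ← intervalIntegral.integral_sub (intervalIntegrable_segment hg.continuous ..)
    (by simp)]
  refine (intervalIntegral.norm_integral_le_of_norm_le_const (C := ‖e‖) fun u hu => ?_).trans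
    (by simp)
  rw [uIoc_of_le zero_le_one] at hu
  refine (hg.norm_sub_le (t + u • e) t).trans ?_
  simp only [NNReal.coe_one, one_mul, add_sub_cancel_left, norm_smul, Real.norm_eq_abs,
    abs_of_pos hu.1]
  exact mul_le_of_le_one_left (norm_nonneg _) hu.2

lemma map_segAvg_sub [CompleteSpace X] [CompleteSpace F] {g : X → F} (hg : Continuous g)
    {β : F →L[ℝ] X}
    (hβ : ∀ x y, β (g x - g y) = x - y) (e x y : X) :
    β (segAvg e g x - segAvg e g y) = x - y := by
  unfold segAvg
  rw [← intervalIntegral.integral_sub (intervalIntegrable_segment hg ..)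
    (intervalIntegrable_segment hg ..), ← ContinuousLinearMap.intervalIntegral_comp_comm]
  · simp [hβ]
  · exact (intervalIntegrable_segment hg ..).sub (intervalIntegrable_segment hg ..)

lemma SmoothAlong.segAvg {g : X → F} (hg : Continuous g) {e : X} {C : ℝ} (h : SmoothAlong e C g)
    (e' : X) : SmoothAlong e C (segAvg e' g) := by
  intro t t' a a'
  have hi := fun t => intervalIntegrable_segment hg t e' 0 1
  unfold _root_.segAvg
  rw [← intervalIntegral.integral_sub (hi _) (hi _), ← intervalIntegral.integral_sub (hi _) (hi _),
    ← intervalIntegral.integral_smul, ← intervalIntegral.integral_smul,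
    ← intervalIntegral.integral_sub ((by fun_prop : Continuous fun u : ℝ =>
        a' • (g (t + a • e + u • e') - g (t + u • e'))).intervalIntegrable _ _)
      ((by fun_prop : Continuous fun u : ℝ =>
        a • (g (t' + a' • e + u • e') - g (t' + u • e'))).intervalIntegrable _ _)]
  refine (intervalIntegral.norm_integral_le_of_norm_le_const fun u _ => ?_).trans
    (by rw [sub_zero, abs_one, mul_one])
  simpa [add_right_comm] using h (t + u • e') (t' + u • e') a a'

lemma segAvg_add_smul_sub {g : X → F} (hg : Continuous g) (e t : X) (h : ℝ) :
    segAvg e g (t + h • e) - segAvg e g t =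
      ∫ u in (0 : ℝ)..h, (g (t + u • e + e) - g (t + u • e)) := by
  have hi := fun t => intervalIntegrable_segment hg t e
  have hshift : ∀ a b c : ℝ, (∫ u in a..b, g (t + (u + c) • e)) =
      ∫ u in (a + c)..(b + c), g (t + u • e) := fun a b c =>
    intervalIntegral.integral_comp_add_right (fun u => g (t + u • e)) c
  have h1 : segAvg e g (t + h • e) = ∫ u in h..(1 + h), g (t + u • e) := by
    have := hshift 0 1 h
    rw [zero_add] at this
    rw [← this]
    simp only [segAvg, add_smul, add_assoc, add_comm (h • e)]
  have h2 : (∫ u in (0 : ℝ)..h, g (t + u • e + e)) = ∫ u in (1 : ℝ)..(1 + h), g (t + u • e) := by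
    have := hshift 0 h 1
    rw [zero_add, add_comm h] at this
    rw [← this]
    simp only [add_smul, one_smul, add_assoc]
  rw [intervalIntegral.integral_sub _ (hi _ _ _), h2, h1, segAvg]
  · have a1 := intervalIntegral.integral_add_adjacent_intervals (hi t 0 h) (hi t h (1 + h))
    have a2 := intervalIntegral.integral_add_adjacent_intervals (hi t 0 1) (hi t 1 (1 + h))
    rw [sub_eq_sub_iff_add_eq_add, add_comm, a1, ← a2, add_comm]
  · exact (by fun_prop : Continuous fun u : ℝ => g (t + u • e + e)).intervalIntegrable _ _

lemma norm_segAvg_add_smul_sub_le [CompleteSpace F] {g : X → F} (hg : LipschitzWith 1 g)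
    (e t s : X) (h : ℝ) :
    ‖segAvg e g (t + h • e) - segAvg e g t - h • (g (s + e) - g s)‖ ≤
      2 * (‖t - s‖ + |h| * ‖e‖) * |h| := by
  have hc := hg.continuous
  have hconst : h • (g (s + e) - g s) = ∫ _ in (0 : ℝ)..h, (g (s + e) - g s) := by
    rw [intervalIntegral.integral_const, sub_zero]
  rw [segAvg_add_smul_sub hc, hconst, ← intervalIntegral.integral_sub
    ((by fun_prop : Continuous fun u : ℝ => g (t + u • e + e) - g (t + u • e)).intervalIntegrable _ _)
    (by simp)]
  refine (intervalIntegral.norm_integral_le_of_norm_le_const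
    (C := 2 * (‖t - s‖ + |h| * ‖e‖)) fun u hu => ?_).trans (by rw [sub_zero])
  have hu' : |u| ≤ |h| := by
    have := abs_sub_left_of_mem_uIcc (uIoc_subset_uIcc hu)
    simpa using this
  have hd : ‖t + u • e - s‖ ≤ ‖t - s‖ + |h| * ‖e‖ := by
    rw [add_sub_right_comm]
    refine (norm_add_le _ _).trans ?_
    rw [norm_smul, Real.norm_eq_abs]
    gcongr
  have e1 := hg.norm_sub_le (t + u • e + e) (s + e)
  have e2 := hg.norm_sub_le (t + u • e) s
  rw [NNReal.coe_one, one_mul] at e1 e2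
  rw [add_sub_add_right_eq_sub] at e1
  rw [sub_sub_sub_comm]
  linarith [norm_sub_le (g (t + u • e + e) - g (s + e)) (g (t + u • e) - g s)]

lemma smoothAlong_segAvg [CompleteSpace F] {g : X → F} (hg : LipschitzWith 1 g) (e : X) :
    SmoothAlong e (2 * (‖e‖ + 1)) (segAvg e g) := by
  intro t t' h h'
  have e1 := norm_segAvg_add_smul_sub_le hg e t t' h
  have e2 := norm_segAvg_add_smul_sub_le hg e t' t' h'
  rw [sub_self, norm_zero, zero_add] at e2
  set a := segAvg e g (t + h • e) - segAvg e g t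
  set b := segAvg e g (t' + h' • e) - segAvg e g t'
  set d := g (t' + e) - g t'
  have : h' • a - h • b = h' • (a - h • d) - h • (b - h' • d) := by module
  rw [this]
  refine (norm_sub_le _ _).trans ?_
  rw [norm_smul, norm_smul, Real.norm_eq_abs, Real.norm_eq_abs]
  have f1 := mul_le_mul_of_nonneg_left e1 (abs_nonneg h')
  have f2 := mul_le_mul_of_nonneg_left e2 (abs_nonneg h)
  have n1 : 0 ≤ |h| * |h'| * (|h| + |h'|) := by positivity
  have n2 : 0 ≤ |h| * |h'| * (‖e‖ * ‖t - t'‖) := by positivity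
  nlinarith

/-- Successive averages of `g` over segments parallel to `e 0`, …, `e (n - 1)`. -/
noncomputable def iterAvg (e : ℕ → X) (g : X → F) : ℕ → X → F
  | 0 => g
  | n + 1 => segAvg (e n) (iterAvg e g n)

lemma lipschitzWith_iterAvg {g : X → F} (hg : LipschitzWith 1 g) (e : ℕ → X) (n : ℕ) :
    LipschitzWith 1 (iterAvg e g n) := by
  induction n with
  | zero => exact hg
  | succ n ih => exact lipschitzWith_segAvg ih _

lemma exists_smoothAlong_all [CompleteSpace F] [CompleteSpace X] {g : X → F} (hg : LipschitzWith 1 g)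
    {β : F →L[ℝ] X} (hβ : ∀ x y, β (g x - g y) = x - y) (e : ℕ → X)
    (he : Summable fun n => ‖e n‖) :
    ∃ G : X → F, LipschitzWith 1 G ∧ (∀ x y, β (G x - G y) = x - y) ∧
      ∀ n, ∃ C, SmoothAlong (e n) C G := by
  have hlip := lipschitzWith_iterAvg hg e
  have hlim : ∀ t, ∃ y, Tendsto (fun n => iterAvg e g n t) atTop (𝓝 y) := fun t =>
    cauchySeq_tendsto_of_complete <| cauchySeq_of_dist_le_of_summable _ (fun n => by
      rw [dist_comm, dist_eq_norm]
      exact norm_segAvg_sub_self_le (hlip n) (e n) t) he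
  choose G hG using hlim
  have hβn : ∀ n x y, β (iterAvg e g n x - iterAvg e g n y) = x - y := by
    intro n
    induction n with
    | zero => exact hβ
    | succ n ih => exact map_segAvg_sub (hlip n).continuous ih (e n)
  refine ⟨G, LipschitzWith.of_dist_le_mul fun x y => ?_, fun x y => ?_, fun n => ?_⟩
  · exact le_of_tendsto ((hG x).dist (hG y)) (.of_forall fun n => (hlip n).dist_le_mul x y)
  · refine tendsto_nhds_unique ((β.continuous.tendsto _).comp ((hG x).sub (hG y))) ?_
    simp [Function.comp_def, hβn]
  · refine ⟨2 * (‖e n‖ + 1), fun t t' h h' => ?_⟩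
    have hs : ∀ m, SmoothAlong (e n) (2 * (‖e n‖ + 1)) (iterAvg e g (n + 1 + m)) := by
      intro m
      induction m with
      | zero => exact smoothAlong_segAvg (hlip n) (e n)
      | succ m ih => exact ih.segAvg (hlip _).continuous _
    refine le_of_tendsto ((((hG (t + h • e n)).sub (hG t)).const_smul h').sub
      (((hG (t' + h' • e n)).sub (hG t')).const_smul h)).norm ?_
    filter_upwards [eventually_ge_atTop (n + 1)] with m hm
    obtain ⟨k, rfl⟩ := Nat.exists_eq_add_of_le hm
    exact hs k t t' h h'

lemma SmoothAlong.exists_hasStrictDirDeriv [CompleteSpace F] {G : X → F} {e : X} {C : ℝ}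
    (h : SmoothAlong e C G) :
    ∃ w, HasStrictDirDeriv G e w := by
  set r : ℕ → ℝ := fun n => 1 / ((n : ℝ) + 1)
  have hr0 : ∀ n, 0 < r n := fun n => by positivity
  have hr : Tendsto r atTop (𝓝 0) := tendsto_one_div_add_atTop_nhds_zero_nat
  set q : ℕ → F := fun n => (r n)⁻¹ • (G (0 + r n • e) - G 0)
  have key : ∀ t a n, ‖(G (t + a • e) - G t) - a • q n‖ ≤ C * (|a| * (|a| + |r n| + ‖t - 0‖)) := by
    intro t a n
    have h1 := h t 0 a (r n)
    have h2 : r n • (G (t + a • e) - G t) - a • (G (0 + r n • e) - G 0) =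
        r n • ((G (t + a • e) - G t) - a • q n) := by
      simp only [q]
      rw [smul_sub (r n) (_ - _), smul_comm (r n) a, smul_inv_smul₀ (hr0 n).ne']
    rw [h2, norm_smul, Real.norm_eq_abs, abs_of_pos (hr0 n)] at h1
    rw [abs_of_pos (hr0 n)]
    refine le_of_mul_le_mul_left (h1.trans_eq ?_) (hr0 n)
    ring
  have hq : CauchySeq q := by
    have hb : ∀ m n, dist (q m) (q n) ≤ C * (r m + r n) := by
      intro m n
      have h1 := key 0 (r m) n
      have h2 : G (0 + r m • e) - G 0 - r m • q n = r m • (q m - q n) := by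
        rw [smul_sub, smul_inv_smul₀ (hr0 m).ne']
      rw [h2, norm_smul, Real.norm_eq_abs, abs_of_pos (hr0 m), sub_self, norm_zero, add_zero,
        abs_of_pos (hr0 n)] at h1
      rw [dist_eq_norm]
      refine le_of_mul_le_mul_left (h1.trans_eq ?_) (hr0 m)
      ring
    have ht : Tendsto (fun mn : ℕ × ℕ => C * (r mn.1 + r mn.2)) atTop (𝓝 0) := by
      rw [← prod_atTop_atTop_eq]
      simpa using ((hr.comp tendsto_fst).add (hr.comp tendsto_snd)).const_mul C
    rw [cauchySeq_iff_tendsto_dist_atTop_0]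
    exact squeeze_zero (fun _ => dist_nonneg) (fun mn => hb mn.1 mn.2) ht
  obtain ⟨w, hw⟩ := cauchySeq_tendsto_of_complete hq
  refine ⟨w, ?_⟩
  have hbound : ∀ t a, ‖G (t + a • e) - G t - a • w‖ ≤ C * (|a| * (|a| + 0 + ‖t - 0‖)) :=
    fun t a => le_of_tendsto_of_tendsto' (tendsto_const_nhds.sub (hw.const_smul a)).norm
      (((((tendsto_const_nhds.add (by simpa using hr.abs)).add tendsto_const_nhds).const_mul
        _).const_mul _)) (key t a)
  have hsmall : (fun x : X × ℝ => C * (|x.2| + ‖x.1‖)) =o[𝓝 0] (fun _ => (1 : ℝ)) := by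
    rw [isLittleO_one_iff]
    exact (by fun_prop : Continuous fun x : X × ℝ => C * (|x.2| + ‖x.1‖)).tendsto' _ _ (by simp)
  refine IsBigO.trans_isLittleO (g := fun x : X × ℝ => C * (|x.2| + ‖x.1‖) * x.2) ?_
    (by simpa using hsmall.mul_isBigO (isBigO_refl (fun x : X × ℝ => x.2) (𝓝 0)))
  refine IsBigO.of_bound 1 (.of_forall fun x => (hbound x.1 x.2).trans ?_)
  rw [one_mul, norm_mul, Real.norm_eq_abs, Real.norm_eq_abs, add_zero, sub_zero]
  calc _ = C * (|x.2| + ‖x.1‖) * |x.2| := by ring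
    _ ≤ _ := by gcongr; exact le_abs_self _

end Averaging

section StrictDirDeriv

variable {X F : Type*} [NormedAddCommGroup X] [NormedSpace ℝ X]
  [NormedAddCommGroup F] [NormedSpace ℝ F] {G : X → F}

namespace HasStrictDirDeriv

protected lemma zero : HasStrictDirDeriv G 0 0 := by
  simp [HasStrictDirDeriv]

lemma add {z z' : X} {w w' : F} (h : HasStrictDirDeriv G z w) (h' : HasStrictDirDeriv G z' w') :
    HasStrictDirDeriv G (z + z') (w + w') := by
  have ht : Tendsto (fun q : X × ℝ => (q.1 + q.2 • z, q.2)) (𝓝 0) (𝓝 0) :=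
    (by fun_prop : Continuous fun q : X × ℝ => (q.1 + q.2 • z, q.2)).tendsto' _ _ (by simp)
  have h₂ := IsLittleO.comp_tendsto h' ht
  refine (IsLittleO.add h h₂).congr_left fun q => ?_
  simp only [Function.comp_apply, smul_add, add_assoc]
  abel

lemma smul {z : X} {w : F} (c : ℝ) (h : HasStrictDirDeriv G z w) :
    HasStrictDirDeriv G (c • z) (c • w) := by
  have ht : Tendsto (fun q : X × ℝ => (q.1, c * q.2)) (𝓝 0) (𝓝 0) :=
    (by fun_prop : Continuous fun q : X × ℝ => (q.1, c * q.2)).tendsto' _ _ (by simp)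
  have := (h.comp_tendsto ht).trans_isBigO
    (isBigO_const_mul_self c (fun q : X × ℝ => q.2) (𝓝 0))
  refine this.congr_left fun q => ?_
  simp only [Function.comp_apply, smul_smul, mul_comm c]

lemma tendsto_slope {z : X} {w : F} (h : HasStrictDirDeriv G z w) :
    Tendsto (fun a : ℝ => a⁻¹ • (G (a • z) - G 0)) (𝓝[≠] 0) (𝓝 w) := by
  have ht : Tendsto (fun a : ℝ => ((0 : X), a)) (𝓝[≠] 0) (𝓝 0) :=
    ((by fun_prop : Continuous fun a : ℝ => ((0 : X), a)).tendsto' 0 0 rfl).mono_left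
      nhdsWithin_le_nhds
  have h1 := (h.comp_tendsto ht).tendsto_inv_smul_nhds_zero
  rw [← tendsto_sub_nhds_zero_iff]
  refine h1.congr' ?_
  filter_upwards [self_mem_nhdsWithin] with a ha
  simp only [Function.comp_apply, zero_add]
  rw [smul_sub, inv_smul_smul₀ ha]

lemma norm_le {z : X} {w : F} (h : HasStrictDirDeriv G z w) (hG : LipschitzWith 1 G) :
    ‖w‖ ≤ ‖z‖ := by
  refine le_of_tendsto h.tendsto_slope.norm ?_
  filter_upwards [self_mem_nhdsWithin] with a ha
  have h1 := hG.norm_sub_le (a • z) 0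
  rw [NNReal.coe_one, one_mul, sub_zero, norm_smul] at h1
  rw [norm_smul, norm_inv]
  exact inv_mul_le_of_le_mul₀ (norm_nonneg _) (norm_nonneg _) h1

lemma map_eq {z : X} {w : F} (h : HasStrictDirDeriv G z w) {β : F →L[ℝ] X}
    (hβ : ∀ x y, β (G x - G y) = x - y) : β w = z := by
  refine tendsto_nhds_unique ((β.continuous.tendsto _).comp h.tendsto_slope)
    (tendsto_const_nhds.congr' ?_)
  filter_upwards [self_mem_nhdsWithin] with a ha
  simp only [Function.comp_apply, map_smul, hβ, sub_zero]
  rw [inv_smul_smul₀ ha]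

lemma of_tendsto (hG : LipschitzWith 1 G) {z : ℕ → X} {w : ℕ → F}
    (h : ∀ n, HasStrictDirDeriv G (z n) (w n)) {z₀ : X} {w₀ : F}
    (hz : Tendsto z atTop (𝓝 z₀)) (hw : Tendsto w atTop (𝓝 w₀)) :
    HasStrictDirDeriv G z₀ w₀ := by
  refine isLittleO_iff.2 fun c hc => ?_
  have hz' := (tendsto_iff_norm_sub_tendsto_zero.1 hz).eventually_lt_const
    (show 0 < c / 3 by positivity)
  have hw' := (tendsto_iff_norm_sub_tendsto_zero.1 hw).eventually_lt_const
    (show 0 < c / 3 by positivity)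
  obtain ⟨n, hn, hn'⟩ := (hz'.and hw').exists
  filter_upwards [isLittleO_iff.1 (h n) (show 0 < c / 3 by positivity)] with q hq
  have h1 := hG.norm_sub_le (q.1 + q.2 • z₀) (q.1 + q.2 • z n)
  rw [NNReal.coe_one, one_mul, add_sub_add_left_eq_sub, ← smul_sub, norm_smul, norm_sub_rev z₀] at h1
  have h2 : ‖q.2 • (w n - w₀)‖ = ‖q.2‖ * ‖w n - w₀‖ := norm_smul _ _
  have h3 : G (q.1 + q.2 • z₀) - G q.1 - q.2 • w₀ =
      (G (q.1 + q.2 • z₀) - G (q.1 + q.2 • z n)) +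
        (G (q.1 + q.2 • z n) - G q.1 - q.2 • w n) + q.2 • (w n - w₀) := by
    rw [smul_sub]; abel
  rw [h3]
  refine norm_add₃_le.trans ?_
  have := norm_nonneg q.2
  nlinarith

end HasStrictDirDeriv

/-- The subspace of directions in which `G` is strictly differentiable at `0`. -/
def strictDirections (G : X → F) : Submodule ℝ X where
  carrier := {z | ∃ w, HasStrictDirDeriv G z w}
  zero_mem' := ⟨0, .zero⟩
  add_mem' := fun ⟨w, hw⟩ ⟨w', hw'⟩ => ⟨w + w', hw.add hw'⟩
  smul_mem' := fun c _ ⟨w, hw⟩ => ⟨c • w, hw.smul c⟩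

lemma HasStrictDirDeriv.sub {z z' : X} {w w' : F} (h : HasStrictDirDeriv G z w)
    (h' : HasStrictDirDeriv G z' w') : HasStrictDirDeriv G (z - z') (w - w') := by
  simpa [sub_eq_add_neg] using h.add (h'.smul (-1))

lemma HasStrictDirDeriv.unique {z : X} {w w' : F} (h : HasStrictDirDeriv G z w)
    (h' : HasStrictDirDeriv G z w') : w = w' :=
  tendsto_nhds_unique h.tendsto_slope h'.tendsto_slope

lemma isClosed_strictDirections [CompleteSpace F] (hG : LipschitzWith 1 G) :
    IsClosed (strictDirections G : Set X) := by
  refine IsSeqClosed.isClosed fun z z₀ hz hlim => ?_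
  choose w hw using hz
  have hc : CauchySeq w := by
    refine Metric.cauchySeq_iff.2 fun ε hε => ?_
    obtain ⟨N, hN⟩ := Metric.cauchySeq_iff.1 hlim.cauchySeq ε hε
    refine ⟨N, fun m hm n hn => lt_of_le_of_lt ?_ (hN m hm n hn)⟩
    rw [dist_eq_norm, dist_eq_norm]
    exact ((hw m).sub (hw n)).norm_le hG
  obtain ⟨w₀, hw₀⟩ := cauchySeq_tendsto_of_complete hc
  exact ⟨w₀, .of_tendsto hG hw hlim hw₀⟩

lemma exists_strictDirDeriv_clm (hG : LipschitzWith 1 G) :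
    ∃ U : strictDirections G →L[ℝ] F, ∀ z : strictDirections G, HasStrictDirDeriv G z (U z) := by
  choose u hu using fun z : strictDirections G => z.2
  let L : strictDirections G →ₗ[ℝ] F :=
    { toFun := u
      map_add' := fun z z' => (hu _).unique ((hu z).add (hu z'))
      map_smul' := fun c z => (hu _).unique ((hu z).smul c) }
  exact ⟨L.mkContinuous 1 fun z => by
    rw [one_mul]
    exact (hu z).norm_le hG, hu⟩

end StrictDirDeriv

section Lifting

variable {X F : Type*} [NormedAddCommGroup X] [NormedSpace ℝ X] [CompleteSpace X]
  [NormedAddCommGroup F] [NormedSpace ℝ F]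

/-- The Godefroy-Kalton lifting: if `β` linearizes a left inverse of the `1`-Lipschitz map `g`, then
`β` has a linear contractive section over a closed subspace containing any given sequence. -/
lemma exists_linear_section [CompleteSpace F] {g : X → F} (hg : LipschitzWith 1 g) {β : F →L[ℝ] X}
    (hβ : ∀ x y, β (g x - g y) = x - y) (z : ℕ → X) :
    ∃ (D : Submodule ℝ X) (U : D →L[ℝ] F), IsClosed (D : Set X) ∧ (∀ n, z n ∈ D) ∧
      (∀ x, ‖U x‖ ≤ ‖x‖) ∧ ∀ x, β (U x) = x := by
  set s : ℕ → ℝ := fun n => (1 / 2) ^ n / (‖z n‖ + 1)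
  have hs : ∀ n, 0 < s n := fun n => by positivity
  have hsum : Summable fun n => ‖s n • z n‖ := by
    refine Summable.of_nonneg_of_le (fun _ => norm_nonneg _) (fun n => ?_) summable_geometric_two
    rw [norm_smul, Real.norm_eq_abs, abs_of_pos (hs n), div_mul_eq_mul_div]
    refine div_le_of_le_mul₀ (by positivity) (by positivity) ?_
    gcongr
    linarith
  obtain ⟨G, hG, hGβ, hGs⟩ := exists_smoothAlong_all hg hβ _ hsum
  obtain ⟨U, hU⟩ := exists_strictDirDeriv_clm hG
  refine ⟨strictDirections G, U, isClosed_strictDirections hG, fun n => ?_,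
    fun x => (hU x).norm_le hG, fun x => (hU x).map_eq hGβ⟩
  obtain ⟨C, hC⟩ := hGs n
  obtain ⟨w, hw⟩ := hC.exists_hasStrictDirDeriv
  refine ⟨(s n)⁻¹ • w, ?_⟩
  simpa [smul_smul, (hs n).ne'] using hw.smul (s n)⁻¹

lemma IsFreeSpace.exists_barycenter {δ : X → F} (hδ : IsFreeSpace δ) :
    ∃ β : F →L[ℝ] X, (∀ x, β (δ x) = x) ∧ ∀ y, ‖β y‖ ≤ ‖y‖ := by
  set e : (X →₀ ℝ) →ₗ[ℝ] F := Finsupp.linearCombination ℝ δ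
  set f : (X →₀ ℝ) →ₗ[ℝ] X := Finsupp.linearCombination ℝ id
  have hdense : DenseRange e := by
    have := hδ.dense_span
    rwa [← Finsupp.range_linearCombination] at this
  have hnorm : ∀ v, ‖f v‖ ≤ 1 * ‖e v‖ := by
    intro v
    rw [one_mul]
    refine NormedSpace.norm_le_dual_bound ℝ _ (norm_nonneg _) fun φ => ?_
    obtain ⟨T, hT, hTn⟩ := hδ.lift (fun x => ULift.up (φ x)) ‖φ‖₊ (by simp; rfl)
      (LipschitzWith.of_dist_le_mul fun x y => φ.lipschitz.dist_le_mul x y)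
    have hTe : T (e v) = ULift.up (φ (f v)) := by
      have : (T : F →ₗ[ℝ] ULift ℝ) ∘ₗ e =
          ULift.moduleEquiv.symm.toLinearMap ∘ₗ (φ : X →ₗ[ℝ] ℝ) ∘ₗ f := by
        ext x
        simp [e, f, hT]
      exact LinearMap.congr_fun this v
    calc ‖φ (f v)‖ = ‖T (e v)‖ := by rw [hTe]; rfl
      _ ≤ ‖T‖ * ‖e v‖ := T.le_opNorm _
      _ ≤ ‖φ‖ * ‖e v‖ := by gcongr; exact hTn
      _ = _ := mul_comm _ _
  refine ⟨f.extendOfNorm e, fun x => ?_, fun y => ?_⟩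
  · simpa [e, f] using LinearMap.extendOfNorm_eq hdense ⟨1, hnorm⟩ (Finsupp.single x 1)
  · simpa using LinearMap.norm_extendOfNorm_apply_le hdense 1 hnorm y

end Lifting

lemma exists_extension_isFinRank {X Y : Type*} [NormedAddCommGroup X] [NormedSpace ℝ X]
    [NormedAddCommGroup Y] [NormedSpace ℝ Y] {D : Submodule ℝ X} (S : D →L[ℝ] Y)
    (hS : IsFinRank S) : ∃ R : X →L[ℝ] Y, IsFinRank R ∧ ∀ x : D, R x = S x := by
  set V := LinearMap.range (S : D →ₗ[ℝ] Y)
  have : FiniteDimensional ℝ V := hS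
  obtain ⟨R, hR⟩ := (S.codRestrict V
    fun x => LinearMap.mem_range_self (S : D →ₗ[ℝ] Y) x).exist_extension_of_finiteDimensional_range
  refine ⟨V.subtypeL ∘L R, ?_, fun x => ?_⟩
  · refine Submodule.finiteDimensional_of_le (S₂ := V) ?_
    rintro _ ⟨x, rfl⟩
    exact (R x).2
  · exact congrArg Subtype.val (DFunLike.congr_fun hR x).symm

lemma PAP.lipPAP {p : ℝ} {X : Type*} [NormedAddCommGroup X] [NormedSpace ℝ X] (h : PAP p X) :
    LipPAP p X := by
  intro K hK ε hε
  obtain ⟨T, hT, hTK⟩ := h K hK ε hε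
  refine ⟨T, ⟨⟨map_zero T, _, T.lipschitz⟩, ?_⟩, fun x hx => norm_sub_rev x (T x) ▸ hTK x hx⟩
  have : FiniteDimensional ℝ (LinearMap.range (T : X →ₗ[ℝ] X)) := hT
  refine Submodule.finiteDimensional_of_le (Submodule.span_le.2 ?_)
    (S₂ := LinearMap.range (T : X →ₗ[ℝ] X))
  rintro _ ⟨x, rfl⟩
  exact ⟨x, rfl⟩

lemma PAP.of_isFreeSpace {p : ℝ} (hp : 1 ≤ p) {X FX : Type*}
    [NormedAddCommGroup X] [NormedSpace ℝ X] [CompleteSpace X]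
    [NormedAddCommGroup FX] [NormedSpace ℝ FX] [CompleteSpace FX]
    {δ : X → FX} (hδ : IsFreeSpace δ) (h : PAP p FX) : PAP p X := by
  rintro K ⟨z, hz, hK⟩ ε hε
  obtain ⟨β, hβδ, hβ⟩ := hδ.exists_barycenter
  obtain ⟨D, U, hD, hzD, hU, hβU⟩ := exists_linear_section hδ.isometry.lipschitz
    (β := β) (fun x y => by rw [map_sub, hβδ, hβδ]) z
  have hKD : ∀ w ∈ K, ∃ (a : ℕ → ℝ) (hw : w ∈ D), InBallConj p a ∧
      HasSum (fun n => a n • U ⟨z n, hzD n⟩) (U ⟨w, hw⟩) := by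
    intro w hw
    obtain ⟨a, ha, hsum⟩ := hK w hw
    have hwD : w ∈ D := hD.mem_of_tendsto hsum
      (.of_forall fun s => D.sum_mem fun n _ => D.smul_mem _ (hzD n))
    have hsumD : HasSum (fun n => a n • (⟨z n, hzD n⟩ : D)) ⟨w, hwD⟩ := by
      rw [HasSum, tendsto_subtype_rng]
      simpa [HasSum] using hsum
    exact ⟨a, hwD, ha, by
      simpa only [map_smul] using U.hasSum hsumD⟩
  have hKU : RelPCompact p {y | ∃ x : D, (x : X) ∈ K ∧ U x = y} := by
    refine ⟨fun n => U ⟨z n, hzD n⟩, ?_, ?_⟩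
    · refine hz.of_nonneg_of_le (fun n => by positivity) fun n => ?_
      exact Real.rpow_le_rpow (norm_nonneg _) (hU _) (by linarith)
    · rintro _ ⟨x, hx, rfl⟩
      obtain ⟨a, _, ha, hsum⟩ := hKD x hx
      exact ⟨a, ha, hsum⟩
  obtain ⟨T, hT, hTK⟩ := h _ hKU ε hε
  have hfin : IsFinRank (β ∘L T ∘L U) := by
    have : FiniteDimensional ℝ (LinearMap.range (T : FX →ₗ[ℝ] FX)) := hT
    refine Submodule.finiteDimensional_of_le
      (S₂ := (LinearMap.range (T : FX →ₗ[ℝ] FX)).map (β : FX →ₗ[ℝ] X)) ?_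
    rintro _ ⟨x, rfl⟩
    exact ⟨T (U x), ⟨U x, rfl⟩, rfl⟩
  obtain ⟨R, hR, hRD⟩ := exists_extension_isFinRank _ hfin
  refine ⟨R, hR, fun w hw => ?_⟩
  obtain ⟨_, hwD, _⟩ := hKD w hw
  have hRw : R w - w = β (T (U ⟨w, hwD⟩) - U ⟨w, hwD⟩) := by
    rw [map_sub, hβU]
    exact congrArg (· - w) (hRD ⟨w, hwD⟩)
  rw [hRw]
  exact (hβ _).trans_lt (hTK _ ⟨⟨w, hwD⟩, hw, rfl⟩)

theorem stmt_15 (p : ℝ) (hp : 1 ≤ p) {X FX : Type*}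
    [NormedAddCommGroup X] [NormedSpace ℝ X] [CompleteSpace X]
    [NormedAddCommGroup FX] [NormedSpace ℝ FX] [CompleteSpace FX]
    (δ : X → FX) (hδ : IsFreeSpace δ) (h : PAP p FX) :
    PAP p X ∧ LipPAP p X :=
  have hX := PAP.of_isFreeSpace hp hδ h
  ⟨hX, hX.lipPAP⟩
end
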